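/- There is a universal constant C > 0 such that for every ε > 0, β ∈ (0,1), integers d, k, T ≥ 1, and monotone histogram queries q_1,…,q_k with sensitivity 1 on ℕ^d, there exists an ε-differentially private (event level) continual-observation mechanism M with input universe {0,1}^d, output space ℝ^k and stream length T such that for every input stream x, with M(x)-probability at least 1 − β, the output sequence (a^1,…,a^T) satisfies |a^t_i − q_i(h^t(x))| ≤ C · ε^{-1} · ( d·log²(d·k·c_max(x)/β) + k·log(k·c_max(x)/β) + log T ) for all t ≤ T and i ≤ k, where c_max(x) = max_{i ≤ k, t ≤ T} q_i(h^t(x)). -/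

import Mathlib

open MeasureTheory

/-- Base-2 logarithm where the argument is clamped below by 2. -/
noncomputable def log2c (z : ℝ) : ℝ := Real.logb 2 (max z 2)

/-- The histogram of a stream of rows from `{0,1}^d` at time step `t`:
the `i`-th column sum of the first `t+1` rows (time steps are 0-indexed). -/
def hist {d T : ℕ} (x : Fin T → Fin d → Bool) (t : Fin T) (i : Fin d) : ℕ :=
  ∑ s : Fin T, if s ≤ t ∧ x s i then 1 else 0

/-- Two streams differ in at most one time step (event-level neighboring). -/
def EventNeighboring {X : Type*} {T : ℕ} (x y : Fin T → X) : Prop :=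
  ∃ t₀ : Fin T, ∀ s : Fin T, s ≠ t₀ → x s = y s

/-- A continual-observation mechanism: a measurable assignment of output
distributions to input streams whose outputs up to time `t` depend only on the
first `t` inputs. -/
def IsCOMech {X O : Type*} [MeasurableSpace X] [MeasurableSpace O] {T : ℕ}
    (M : (Fin T → X) → Measure (Fin T → O)) : Prop :=
  Measurable M ∧ (∀ x, IsProbabilityMeasure (M x)) ∧
    ∀ (t : Fin T) (x y : Fin T → X), (∀ s, s ≤ t → x s = y s) →
      (M x).map (fun a (s : {s : Fin T // s ≤ t}) => a s.1) =
      (M y).map (fun a (s : {s : Fin T // s ≤ t}) => a s.1)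

/-- `ε`-differential privacy (event level) for a continual-observation mechanism. -/
def IsEventDP {X O : Type*} [MeasurableSpace X] [MeasurableSpace O] {T : ℕ} (ε : ℝ)
    (M : (Fin T → X) → Measure (Fin T → O)) : Prop :=
  ∀ x y, EventNeighboring x y → ∀ S : Set (Fin T → O), MeasurableSet S →
    M x S ≤ ENNReal.ofReal (Real.exp ε) * M y S

/-- A monotone histogram query with sensitivity 1. -/
def MonotoneHistQuery {d : ℕ} (q : (Fin d → ℕ) → ℝ) : Prop :=
  (∀ v, 0 ≤ q v) ∧
  q (fun _ => 0) = 0 ∧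
  (∀ v w, (∀ i, v i ≤ w i) → q v ≤ q w) ∧
  (∀ v w : Fin d → ℕ, (∀ i, ((v i : ℤ) - (w i : ℤ)).natAbs ≤ 1) → |q v - q w| ≤ 1)

/-- The maximum query value attained on the given input at any time step. -/
noncomputable def cmax {d k T : ℕ} (q : Fin k → (Fin d → ℕ) → ℝ)
    (x : Fin T → Fin d → Bool) : ℝ :=
  ⨆ i : Fin k, ⨆ t : Fin T, q i (hist x t)


lemma comech_of_causal {X O Ω : Type*} [MeasurableSpace X] [MeasurableSpace O] [MeasurableSpace Ω]
    [Finite X] [MeasurableSingletonClass X]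
    [DiscreteMeasurableSpace Ω] {T : ℕ} (P : Measure Ω) [IsProbabilityMeasure P]
    (Φ : (Fin T → X) → Ω → Fin T → O)
    (hΦ : ∀ (t : Fin T) (x y : Fin T → X), (∀ s, s ≤ t → x s = y s) → ∀ ω, Φ x ω t = Φ y ω t) :
    IsCOMech (fun x => P.map (Φ x)) := by
  refine ⟨Measurable.of_discrete, fun x => Measure.isProbabilityMeasure_map .of_discrete, ?_⟩
  intro t x y h
  have hm : Measurable (fun (a : Fin T → O) (s : {s : Fin T // s ≤ t}) => a s.1) := by fun_prop
  rw [Measure.map_map hm .of_discrete, Measure.map_map hm .of_discrete]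
  congr 1
  funext ω s
  exact hΦ s.1 x y (fun r hr => h r (hr.trans s.2)) ω

lemma coupling_le {Ω O : Type*} [MeasurableSpace Ω] [Countable Ω] [MeasurableSingletonClass Ω]
    (P : Measure Ω) (c : ENNReal) (F G : Ω → O) (ψ : Ω → Ω) (hψ : Function.Injective ψ)
    (hFG : ∀ ω, G (ψ ω) = F ω) (hc : ∀ ω, P {ω} ≤ c * P {ψ ω}) (S : Set O) :
    P (F ⁻¹' S) ≤ c * P (G ⁻¹' S) := by
  classical
  have key : ∀ A : Set Ω, P A = ∑' ω, A.indicator (fun ω => P {ω}) ω := by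
    intro A
    rw [← lintegral_indicator_one (Set.to_countable A).measurableSet, lintegral_countable']
    refine tsum_congr fun ω => ?_
    by_cases h : ω ∈ A <;> simp [h]
  rw [key, key, ← ENNReal.tsum_mul_left]
  calc ∑' ω, (F ⁻¹' S).indicator (fun ω => P {ω}) ω
      ≤ ∑' ω, (fun ω => c * (G ⁻¹' S).indicator (fun ω => P {ω}) ω) (ψ ω) := by
        refine ENNReal.tsum_le_tsum fun ω => ?_
        by_cases h : F ω ∈ S
        · have h2 : G (ψ ω) ∈ S := by rw [hFG]; exact h
          simpa [Set.indicator, h, h2] using hc ω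
        · simp [Set.indicator, h]
    _ ≤ _ := ENNReal.tsum_comp_le_tsum_of_injective hψ _

lemma hasSum_int_geom (r : ℝ) (h0 : 0 ≤ r) (h1 : r < 1) :
    HasSum (fun z : ℤ => r ^ z.natAbs) ((1 - r)⁻¹ + r * (1 - r)⁻¹) := by
  have hg := hasSum_geometric_of_lt_one h0 h1
  apply HasSum.of_nat_of_neg_add_one
  · simpa using hg
  · have := hg.mul_left r
    have e : (fun n : ℕ => r ^ (-((n:ℤ) + 1)).natAbs) = fun n : ℕ => r * r ^ n := by
      funext n
      have : (-((n:ℤ) + 1)).natAbs = n + 1 := by omega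
      rw [this, pow_succ, mul_comm]
    rw [e]; exact this

lemma exists_dlap (a : ℝ) (ha : 0 < a) : ∃ μ : Measure ℤ, IsProbabilityMeasure μ ∧
    (∀ z s : ℤ, μ {z} ≤ ENNReal.ofReal (Real.exp (a * |(s:ℝ)|)) * μ {z + s}) ∧
    ∫⁻ z, ENNReal.ofReal (Real.exp (a * |(z:ℝ)| / 2)) ∂μ ≤ 2 := by
  set w : ℤ → ENNReal := fun z => ENNReal.ofReal (Real.exp (-a * |(z:ℝ)|)) with hw
  set r := Real.exp (-a/2) with hr
  have hr0 : 0 < r := Real.exp_pos _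
  have hr1 : r < 1 := by rw [hr, ← Real.exp_zero, Real.exp_lt_exp]; linarith
  have hr2 : r ^ 2 < 1 := by nlinarith
  have hrz : ∀ z : ℤ, Real.exp (-a * |(z:ℝ)| / 2) = r ^ z.natAbs := by
    intro z
    rw [hr, ← Real.exp_nat_mul]
    congr 1
    have : ((z.natAbs : ℕ) : ℝ) = |(z:ℝ)| := by rw [Nat.cast_natAbs]; simp
    rw [this]; ring
  have hrz2 : ∀ z : ℤ, Real.exp (-a * |(z:ℝ)|) = (r ^ 2) ^ z.natAbs := by
    intro z
    rw [← pow_mul, mul_comm 2, pow_mul, ← hrz, ← Real.exp_nat_mul]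
    congr 1; push_cast; ring
  have hs1 := hasSum_int_geom r hr0.le hr1
  have hs2 := hasSum_int_geom (r^2) (by positivity) hr2
  have hS : ∑' z, w z = ENNReal.ofReal ((1 - r^2)⁻¹ + r^2 * (1 - r^2)⁻¹) := by
    rw [← hs2.tsum_eq, ENNReal.ofReal_tsum_of_nonneg (fun z => by positivity) hs2.summable]
    simp only [hw, hrz2]
  have hS1 : ∑' z : ℤ, ENNReal.ofReal (Real.exp (-a * |(z:ℝ)| / 2)) =
      ENNReal.ofReal ((1 - r)⁻¹ + r * (1 - r)⁻¹) := by
    rw [← hs1.tsum_eq, ENNReal.ofReal_tsum_of_nonneg (fun z => by positivity) hs1.summable]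
    simp only [hrz]
  have hSpos : 0 < (1 - r^2)⁻¹ + r^2 * (1 - r^2)⁻¹ := by
    have : 0 < 1 - r^2 := by linarith
    positivity
  have h0 : ∑' z, w z ≠ 0 := by rw [hS]; simpa using hSpos
  have ht : ∑' z, w z ≠ ⊤ := by rw [hS]; exact ENNReal.ofReal_ne_top
  have hsing : ∀ z, (PMF.normalize w h0 ht).toMeasure {z} = w z * (∑' x, w x)⁻¹ := by
    intro z
    rw [PMF.toMeasure_apply_singleton _ _ (measurableSet_singleton z), PMF.normalize_apply]
  refine ⟨(PMF.normalize w h0 ht).toMeasure, inferInstance, ?_, ?_⟩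
  · intro z s
    rw [hsing, hsing, ← mul_assoc]
    gcongr
    rw [hw, ← ENNReal.ofReal_mul (Real.exp_pos _).le, ← Real.exp_add]
    apply ENNReal.ofReal_le_ofReal
    apply Real.exp_le_exp.2
    push_cast
    have := abs_add_le (z:ℝ) s
    nlinarith
  · rw [lintegral_countable']
    simp_rw [hsing, ← mul_assoc]
    rw [ENNReal.tsum_mul_right, ← div_eq_mul_inv]
    apply ENNReal.div_le_of_le_mul
    have : ∀ z : ℤ, ENNReal.ofReal (Real.exp (a * |(z:ℝ)| / 2)) * w z =
        ENNReal.ofReal (Real.exp (-a * |(z:ℝ)| / 2)) := by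
      intro z
      rw [hw, ← ENNReal.ofReal_mul (Real.exp_pos _).le, ← Real.exp_add]
      congr 2; ring
    simp_rw [this]
    rw [hS1, hS, ← ENNReal.ofReal_ofNat 2, ← ENNReal.ofReal_mul (by norm_num)]
    apply ENNReal.ofReal_le_ofReal
    have e1 : 0 < 1 - r := by linarith
    have e2 : 1 - r^2 = (1-r)*(1+r) := by ring
    rw [e2, mul_inv]
    have e3 : (1+r) * (1+r)⁻¹ = 1 := mul_inv_cancel₀ (by positivity)
    have e4 : 0 < (1-r)⁻¹ := by positivity
    have e5 : 0 < (1+r)⁻¹ := by positivity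
    have : (1 - r)⁻¹ + r * (1 - r)⁻¹ = (1-r)⁻¹ * (1+r)⁻¹ * (1+r)^2 := by
      field_simp
    rw [this]
    have h6 : (1+r)^2 ≤ 2 * (1 + r^2) := by nlinarith [sq_nonneg (1-r)]
    have := mul_le_mul_of_nonneg_left h6 (mul_pos e4 e5).le
    nlinarith

lemma pi_shift_le {ι : Type*} [Fintype ι] (μ : ι → Measure ℤ) [∀ i, IsProbabilityMeasure (μ i)]
    (a : ι → ℝ)
    (h : ∀ i, ∀ z s : ℤ, μ i {z} ≤ ENNReal.ofReal (Real.exp (a i * |(s:ℝ)|)) * μ i {z + s})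
    (ε : ℝ) (s : ι → ℤ) (hs : ∑ i, a i * |(s i : ℝ)| ≤ ε) (ω : ι → ℤ) :
    Measure.pi μ {ω} ≤ ENNReal.ofReal (Real.exp ε) * Measure.pi μ {ω + s} := by
  rw [Measure.pi_singleton, Measure.pi_singleton]
  calc ∏ i, μ i {ω i} ≤ ∏ i, (ENNReal.ofReal (Real.exp (a i * |(s i:ℝ)|)) * μ i {(ω + s) i}) :=
        Finset.prod_le_prod' fun i _ => h i _ _
    _ = ENNReal.ofReal (Real.exp (∑ i, a i * |(s i : ℝ)|)) * ∏ i, μ i {(ω + s) i} := by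
        rw [Finset.prod_mul_distrib, Real.exp_sum,
          ENNReal.ofReal_prod_of_nonneg (fun i _ => (Real.exp_pos _).le)]
    _ ≤ _ := by gcongr

lemma pi_tail {ι : Type*} [Fintype ι] (μ : ι → Measure ℤ) [∀ i, IsProbabilityMeasure (μ i)]
    (a : ι → ℝ)
    (h : ∀ i, ∫⁻ z, ENNReal.ofReal (Real.exp (a i * |(z:ℝ)| / 2)) ∂(μ i) ≤ 2)
    (A : Finset ι) (s : ℝ) :
    Measure.pi μ {ω | s < ∑ i ∈ A, a i * |(ω i : ℝ)|} ≤
      ENNReal.ofReal (2 ^ A.card * Real.exp (-s/2)) := by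
  have hi := ProbabilityTheory.iIndepFun_pi (μ := μ)
    (X := fun i (z:ℤ) => ENNReal.ofReal (Real.exp (a i * |(z:ℝ)| / 2)))
    (fun i => .of_discrete)
  have hl := ProbabilityTheory.lintegral_prod_eq_prod_lintegral_of_indepFun A _ hi
    (fun i => .of_discrete)
  have hb : ∫⁻ ω, ∏ i ∈ A, ENNReal.ofReal (Real.exp (a i * |((ω i : ℤ):ℝ)| / 2)) ∂(Measure.pi μ)
      ≤ 2 ^ A.card := by
    rw [hl, ← Finset.prod_const]
    refine Finset.prod_le_prod' fun i _ => ?_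
    have := (measurePreserving_eval μ i).lintegral_comp
      (f := fun (z:ℤ) => ENNReal.ofReal (Real.exp (a i * |(z:ℝ)| / 2))) .of_discrete
    exact this.trans_le (h i)
  have hm := mul_meas_ge_le_lintegral (μ := Measure.pi μ)
    (f := fun ω => ∏ i ∈ A, ENNReal.ofReal (Real.exp (a i * |((ω i : ℤ):ℝ)| / 2)))
    .of_discrete (ENNReal.ofReal (Real.exp (s/2)))
  have hsub : {ω : ι → ℤ | s < ∑ i ∈ A, a i * |(ω i : ℝ)|} ⊆
      {ω | ENNReal.ofReal (Real.exp (s/2)) ≤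
        ∏ i ∈ A, ENNReal.ofReal (Real.exp (a i * |((ω i : ℤ):ℝ)| / 2))} := by
    intro ω hω
    simp only [Set.mem_ofPred_eq] at hω ⊢
    rw [← ENNReal.ofReal_prod_of_nonneg (fun i _ => (Real.exp_pos _).le), ← Real.exp_sum]
    apply ENNReal.ofReal_le_ofReal
    apply Real.exp_le_exp.2
    rw [← Finset.sum_div]
    linarith
  refine (measure_mono hsub).trans ?_
  have h3 := hm.trans hb
  set p := (Measure.pi μ) {ω | ENNReal.ofReal (Real.exp (s/2)) ≤
        ∏ i ∈ A, ENNReal.ofReal (Real.exp (a i * |((ω i : ℤ):ℝ)| / 2))}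
  calc p = ENNReal.ofReal (Real.exp (-s/2)) * (ENNReal.ofReal (Real.exp (s/2)) * p) := by
        rw [← mul_assoc, ← ENNReal.ofReal_mul (Real.exp_pos _).le, ← Real.exp_add]
        have : -s/2 + s/2 = 0 := by ring
        simp [this]
    _ ≤ ENNReal.ofReal (Real.exp (-s/2)) * 2 ^ A.card := by gcongr
    _ = _ := by
        rw [mul_comm, ENNReal.ofReal_mul (by positivity), ENNReal.ofReal_pow (by norm_num)]
        simp

lemma exists_rr (d : ℕ) (ε : ℝ) (hε : 0 < ε) : ∃ μ : Measure (Fin d → Bool),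
    IsProbabilityMeasure μ ∧
    (∀ z z', μ {z} ≤ ENNReal.ofReal (Real.exp ε) * μ {z'}) ∧
    μ {fun _ => false}ᶜ ≤ ENNReal.ofReal (2 ^ d * Real.exp (-ε)) := by
  classical
  set η := Real.exp (-ε) with hη
  have hη0 : 0 < η := Real.exp_pos _
  have hη1 : η < 1 := by rw [hη, ← Real.exp_zero, Real.exp_lt_exp]; linarith
  set S : ℝ := (1 - η) + η * 2 ^ d with hS
  have h2 : (1:ℝ) ≤ 2 ^ d := one_le_pow₀ (by norm_num)
  have hS1 : 1 ≤ S := by nlinarith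
  set r : Fin d → Bool := fun _ => false
  set μ : Measure (Fin d → Bool) := ENNReal.ofReal (S⁻¹ * (1 - η)) • Measure.dirac r
    + ENNReal.ofReal (S⁻¹ * η) • Measure.count with hμ
  have hSi : 0 < S⁻¹ := by positivity
  have hsing : ∀ z, μ {z} = ENNReal.ofReal (S⁻¹ * ((if z = r then (1-η) else 0) + η)) := by
    intro z
    simp only [hμ, Measure.add_apply, Measure.smul_apply, smul_eq_mul, Measure.count_singleton,
      mul_one, Measure.dirac_apply]
    by_cases h : z = r
    · subst h
      simp only [Set.indicator, Set.mem_singleton_iff, if_true, Pi.one_apply, mul_one]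
      rw [← ENNReal.ofReal_add (by apply mul_nonneg hSi.le; linarith) (by positivity)]
      congr 1; ring
    · have : ¬ r = z := fun e => h e.symm
      simp [Set.indicator, h, this]
  refine ⟨μ, ⟨?_⟩, ?_, ?_⟩
  · simp only [hμ, Measure.add_apply, Measure.smul_apply, smul_eq_mul, measure_univ, mul_one,
      Measure.count_univ]
    have : (ENat.card (Fin d → Bool) : ENNReal) = ENNReal.ofReal (2 ^ d) := by
      rw [ENat.card_eq_coe_fintype_card]
      simp [ENNReal.ofReal_pow]
    rw [this, ← ENNReal.ofReal_mul (by positivity),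
      ← ENNReal.ofReal_add (by apply mul_nonneg hSi.le; linarith) (by positivity)]
    have : S⁻¹ * (1 - η) + S⁻¹ * η * 2 ^ d = 1 := by
      have : S⁻¹ * S = 1 := inv_mul_cancel₀ (by positivity)
      linear_combination this - S⁻¹ * hS
    simp [this]
  · intro z z'
    rw [hsing, hsing, ← ENNReal.ofReal_mul (Real.exp_pos _).le]
    apply ENNReal.ofReal_le_ofReal
    have h1 : (if z = r then (1-η) else 0) + η ≤ 1 := by split_ifs <;> linarith
    have h3 : η ≤ (if z' = r then (1-η) else 0) + η := by split_ifs <;> linarith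
    have h4 : Real.exp ε * η = 1 := by rw [hη, ← Real.exp_add]; simp
    calc S⁻¹ * ((if z = r then (1-η) else 0) + η) ≤ S⁻¹ * 1 := by gcongr
      _ = Real.exp ε * (S⁻¹ * η) := by rw [← h4]; ring
      _ ≤ _ := by gcongr
  · have hc : μ {r}ᶜ ≤ ENNReal.ofReal (S⁻¹ * η) * Measure.count (Set.univ : Set (Fin d → Bool)) := by
      simp only [hμ, Measure.add_apply, Measure.smul_apply, smul_eq_mul, Measure.dirac_apply]
      simp only [Set.indicator, Set.mem_compl_iff, Set.mem_singleton_iff, not_true, if_false,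
        mul_zero, zero_add]
      gcongr
      exact Set.subset_univ _
    refine hc.trans ?_
    rw [Measure.count_univ]
    have : (ENat.card (Fin d → Bool) : ENNReal) = ENNReal.ofReal (2 ^ d) := by
      rw [ENat.card_eq_coe_fintype_card]
      simp [ENNReal.ofReal_pow]
    rw [this, ← ENNReal.ofReal_mul (by positivity)]
    apply ENNReal.ofReal_le_ofReal
    have : S⁻¹ ≤ 1 := inv_le_one_of_one_le₀ hS1
    have : S⁻¹ * η ≤ 1 * η := by gcongr
    nlinarith

lemma hist_congr {d T : ℕ} {x y : Fin T → Fin d → Bool} {t : Fin T}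
    (h : ∀ s, s ≤ t → x s = y s) : hist x t = hist y t := by
  funext i
  unfold hist
  refine Finset.sum_congr rfl fun s _ => ?_
  by_cases hs : s ≤ t
  · rw [h s hs]
  · simp [hs]

lemma prob_ge_of_compl {Ω : Type*} [MeasurableSpace Ω] (P : Measure Ω) [IsProbabilityMeasure P]
    (G B : Set Ω) (β : ℝ) (h : Gᶜ ⊆ B) (hB : P B ≤ ENNReal.ofReal β) (hβ : 0 ≤ β) :
    ENNReal.ofReal (1 - β) ≤ P G := by
  have h1 : (1 : ENNReal) ≤ P G + P B := by
    rw [← measure_univ (μ := P)]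
    refine (measure_mono ?_).trans (measure_union_le G B)
    intro ω _
    by_cases hω : ω ∈ G
    · exact Or.inl hω
    · exact Or.inr (h hω)
  rw [ENNReal.ofReal_sub _ hβ, ENNReal.ofReal_one]
  rw [tsub_le_iff_right]
  exact h1.trans (by gcongr)

lemma regimeA (ε β : ℝ) (d k T : ℕ) (hε : 0 < ε)
    (hβ : (T : ℝ) * (2 ^ d * Real.exp (-ε)) ≤ β) (q : Fin k → (Fin d → ℕ) → ℝ) :
    ∃ M : (Fin T → Fin d → Bool) → Measure (Fin T → Fin k → ℝ),
          IsCOMech M ∧ IsEventDP ε M ∧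
          ∀ x, ENNReal.ofReal (1 - β) ≤
            M x {a | ∀ (t : Fin T) (i : Fin k), a t i = q i (hist x t)} := by
  classical
  obtain ⟨μ, hμ, h1, h2⟩ := exists_rr d ε hε
  set P : Measure (Fin T → Fin d → Bool) := Measure.pi (fun _ => μ)
  let Φ : (Fin T → Fin d → Bool) → (Fin T → Fin d → Bool) → Fin T → Fin k → ℝ :=
    fun x ω t i => q i (hist (fun s j => xor (x s j) (ω s j)) t)
  have hβ0 : 0 ≤ β := le_trans (by positivity) hβ
  refine ⟨fun x => P.map (Φ x), comech_of_causal P Φ ?_, ?_, ?_⟩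
  · intro t x y h ω
    funext i
    simp only [Φ]
    rw [hist_congr (t := t)]
    intro s hs
    rw [h s hs]
  · rintro x y ⟨t₀, ht⟩ S hS
    rw [Measure.map_apply .of_discrete hS, Measure.map_apply .of_discrete hS]
    refine coupling_le P _ (Φ x) (Φ y) (fun ω t j => xor (ω t j) (xor (x t j) (y t j))) ?_ ?_ ?_ S
    · intro ω ω' h
      funext t j
      have := congrFun (congrFun h t) j
      simpa using this
    · intro ω
      funext t i
      simp only [Φ]
      congr 2
      funext s j
      cases x s j <;> cases y s j <;> cases ω s j <;> rfl
    · intro ω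
      rw [Measure.pi_singleton, Measure.pi_singleton]
      have : ENNReal.ofReal (Real.exp ε) =
          ∏ t : Fin T, if t = t₀ then ENNReal.ofReal (Real.exp ε) else 1 := by simp
      rw [this, ← Finset.prod_mul_distrib]
      refine Finset.prod_le_prod' fun t _ => ?_
      by_cases h : t = t₀
      · simp only [h, if_true]; exact h1 _ _
      · simp [h, ht t h]
  · intro x
    refine le_trans ?_ (Measure.le_map_apply .of_discrete _)
    refine prob_ge_of_compl P _ (⋃ t : Fin T, {ω | ω t ∈ ({fun _ => false}ᶜ : Set (Fin d → Bool))})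
      β ?_ ?_ hβ0
    · intro ω hω
      by_contra hn
      apply hω
      simp only [Set.mem_iUnion, not_exists] at hn
      intro t i
      simp only [Φ]
      congr 2
      funext s j
      have := hn s
      have h3 : ω s = fun _ => false := by
        by_contra h4
        exact this h4
      simp [h3]
    · refine (measure_iUnion_le _).trans ?_
      rw [tsum_fintype]
      have : ∀ t : Fin T, P {ω | ω t ∈ ({fun _ => false}ᶜ : Set (Fin d → Bool))} ≤
          ENNReal.ofReal (2 ^ d * Real.exp (-ε)) := by
        intro t
        have := (measurePreserving_eval (fun _ : Fin T => μ) t).measure_preimage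
          (s := ({fun _ => false}ᶜ : Set (Fin d → Bool))) (Set.toFinite _).measurableSet.nullMeasurableSet
        exact this.trans_le h2
      refine (Finset.sum_le_sum fun t _ => this t).trans ?_
      rw [Finset.sum_const, Finset.card_univ, Fintype.card_fin, nsmul_eq_mul,
        ← ENNReal.ofReal_natCast, ← ENNReal.ofReal_mul (by positivity)]
      exact ENNReal.ofReal_le_ofReal hβ

structure HSt (d : ℕ) where
  j : ℕ
  h : Fin d → ℕ
  D : Fin d → ℕ

def hcum {d : ℕ} (X : ℕ → Fin d → ℕ) (n : ℕ) (i : Fin d) : ℕ := ∑ s ∈ Finset.range n, X s i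

open Classical in
noncomputable def hrun {d k : ℕ} (q : Fin k → (Fin d → ℕ) → ℝ) (τ : ℕ → ℝ) (X : ℕ → Fin d → ℕ)
    (ν ρ : ℕ → ℤ) (N : ℕ → Fin d → ℤ) : ℕ → HSt d
  | 0 => ⟨0, fun _ => 0, fun _ => 0⟩
  | n + 1 =>
    let s := hrun q τ X ν ρ N n
    if ∃ i, τ s.j + ρ s.j ≤ q i (s.h + (s.D + X n)) - q i s.h + ν n then
      ⟨s.j + 1, fun l => ((hcum X (n+1) l : ℤ) + N (s.j + 1) l).toNat, fun _ => 0⟩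
    else ⟨s.j, s.h, s.D + X n⟩

section
variable {d k : ℕ} {q : Fin k → (Fin d → ℕ) → ℝ} {τ : ℕ → ℝ} {X Y : ℕ → Fin d → ℕ}
    {ν ρ ν' ρ' : ℕ → ℤ} {N N' : ℕ → Fin d → ℤ}

lemma hrun_pos {n : ℕ} (h : ∃ i, τ (hrun q τ X ν ρ N n).j + ρ (hrun q τ X ν ρ N n).j ≤
      q i ((hrun q τ X ν ρ N n).h + ((hrun q τ X ν ρ N n).D + X n)) - q i (hrun q τ X ν ρ N n).h
        + ν n) :
    hrun q τ X ν ρ N (n+1) = ⟨(hrun q τ X ν ρ N n).j + 1,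
      fun l => ((hcum X (n+1) l : ℤ) + N ((hrun q τ X ν ρ N n).j + 1) l).toNat, fun _ => 0⟩ := by
  rw [hrun]; simp only [h, if_true]

lemma hrun_neg {n : ℕ} (h : ¬ ∃ i, τ (hrun q τ X ν ρ N n).j + ρ (hrun q τ X ν ρ N n).j ≤
      q i ((hrun q τ X ν ρ N n).h + ((hrun q τ X ν ρ N n).D + X n)) - q i (hrun q τ X ν ρ N n).h
        + ν n) :
    hrun q τ X ν ρ N (n+1) = ⟨(hrun q τ X ν ρ N n).j, (hrun q τ X ν ρ N n).h,
      (hrun q τ X ν ρ N n).D + X n⟩ := by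
  rw [hrun]; simp only [h, if_false]

lemma hrun_congr {n : ℕ} (h : ∀ s < n, X s = Y s) :
    hrun q τ X ν ρ N n = hrun q τ Y ν ρ N n := by
  induction n with
  | zero => rfl
  | succ n ih =>
    have hh : hcum X (n+1) = hcum Y (n+1) := by
      funext l
      unfold hcum
      exact Finset.sum_congr rfl fun s hs => by rw [h s (Finset.mem_range.1 hs)]
    rw [hrun, hrun, ih (fun s hs => h s (by omega)), h n (by omega), hh]

lemma hrun_j_succ (n : ℕ) : (hrun q τ X ν ρ N (n+1)).j = (hrun q τ X ν ρ N n).j ∨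
    (hrun q τ X ν ρ N (n+1)).j = (hrun q τ X ν ρ N n).j + 1 := by
  by_cases h : ∃ i, τ (hrun q τ X ν ρ N n).j + ρ (hrun q τ X ν ρ N n).j ≤
      q i ((hrun q τ X ν ρ N n).h + ((hrun q τ X ν ρ N n).D + X n)) - q i (hrun q τ X ν ρ N n).h
        + ν n
  · right; rw [hrun_pos h]
  · left; rw [hrun_neg h]

lemma hrun_j_mono : Monotone (fun n => (hrun q τ X ν ρ N n).j) :=
  monotone_nat_of_le_succ fun n => by
    rcases hrun_j_succ (q := q) (τ := τ) (X := X) (ν := ν) (ρ := ρ) (N := N) n with h | h <;>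
    omega

lemma hrun_j_le (n : ℕ) : (hrun q τ X ν ρ N n).j ≤ n := by
  induction n with
  | zero => exact le_rfl
  | succ n ih =>
    rcases hrun_j_succ (q := q) (τ := τ) (X := X) (ν := ν) (ρ := ρ) (N := N) n with h | h <;> omega

/-- The coupling theorem. -/
lemma hrun_coupling (hq : ∀ i, MonotoneHistQuery (q i)) (T t₀ : ℕ)
    (hXY : ∀ n, n ≠ t₀ → X n = Y n) (hX1 : ∀ i, X t₀ i ≤ 1) (hY1 : ∀ i, Y t₀ i ≤ 1)
    (J : ℕ) (hJ : J = (hrun q τ X ν ρ N t₀).j)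
    (hρ : ∀ j < T, ρ' j = ρ j + if j = J then 1 else 0)
    (hν : ∀ n < T, ν' n = ν n + if (hrun q τ X ν ρ N n).j = J ∧ (hrun q τ X ν ρ N (n+1)).j = J + 1
      then 2 else 0)
    (hN : ∀ j ≤ T, ∀ i, N' j i = N j i + if J < j then ((X t₀ i : ℤ) - Y t₀ i) else 0)
    (n : ℕ) (hn : n ≤ T) :
    (hrun q τ Y ν' ρ' N' n).j = (hrun q τ X ν ρ N n).j ∧
    (hrun q τ Y ν' ρ' N' n).h = (hrun q τ X ν ρ N n).h ∧
    ∀ i, (hrun q τ Y ν' ρ' N' n).D i +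
        (if t₀ < n ∧ (hrun q τ X ν ρ N n).j = J then X t₀ i else 0) =
      (hrun q τ X ν ρ N n).D i +
        (if t₀ < n ∧ (hrun q τ X ν ρ N n).j = J then Y t₀ i else 0) := by
  induction n with
  | zero => simp [hrun]
  | succ n ih =>
    obtain ⟨i1, i2, i3⟩ := ih (by omega)
    have hmono := hrun_j_mono (q := q) (τ := τ) (X := X) (ν := ν) (ρ := ρ) (N := N)
    have hjle : (hrun q τ X ν ρ N n).j ≤ n := hrun_j_le n
    have hsucc := hrun_j_succ (q := q) (τ := τ) (X := X) (ν := ν) (ρ := ρ) (N := N) n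
    set A := hrun q τ X ν ρ N n with hA
    set B := hrun q τ Y ν' ρ' N' n with hB
    have hlt : n < t₀ → (hrun q τ X ν ρ N (n+1)).j ≤ J := fun h => by
      rw [hJ]; exact hmono (by omega : n + 1 ≤ t₀)
    have hge : t₀ ≤ n → J ≤ A.j := fun h => by rw [hJ]; exact hmono h
    -- cumulative histograms
    have hH : ∀ i, hcum Y (n+1) i + (if t₀ < n + 1 then X t₀ i else 0) =
        hcum X (n+1) i + (if t₀ < n + 1 then Y t₀ i else 0) := by
      intro i
      unfold hcum
      by_cases h : t₀ < n + 1
      · simp only [h, if_true]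
        rw [← Finset.add_sum_erase _ _ (Finset.mem_range.2 h),
          ← Finset.add_sum_erase (Finset.range (n+1)) (fun s => X s i) (Finset.mem_range.2 h)]
        have : ∑ s ∈ (Finset.range (n+1)).erase t₀, Y s i =
            ∑ s ∈ (Finset.range (n+1)).erase t₀, X s i :=
          Finset.sum_congr rfl fun s hs => by rw [hXY s (Finset.ne_of_mem_erase hs)]
        rw [this]; ring
      · simp only [h, if_false]
        congr 1
        exact Finset.sum_congr rfl fun s hs => by
          rw [hXY s (by have := Finset.mem_range.1 hs; omega)]
    -- pending increments
    have hD : ∀ i, (B.D + Y n) i + (if t₀ < n + 1 ∧ A.j = J then X t₀ i else 0) =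
        (A.D + X n) i + (if t₀ < n + 1 ∧ A.j = J then Y t₀ i else 0) := by
      intro i
      have h3 := i3 i
      simp only [Pi.add_apply]
      rcases lt_trichotomy n t₀ with h | h | h
      · have e1 : ¬ t₀ < n := by omega
        have e2 : ¬ t₀ < n + 1 := by omega
        simp only [e1, e2, false_and, if_false] at h3 ⊢
        rw [hXY n (by omega)]; omega
      · have e1 : ¬ t₀ < n := by omega
        have e2 : t₀ < n + 1 := by omega
        have e3 : A.j = J := by rw [hJ, hA, h]
        simp only [e1, e2, e3, false_and, true_and, if_false, if_true] at h3 ⊢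
        rw [h]; omega
      · have e1 : t₀ < n := by omega
        have e2 : t₀ < n + 1 := by omega
        simp only [e1, e2, true_and] at h3 ⊢
        rw [hXY n (by omega)]; omega
    have hsame : ¬ (t₀ < n + 1 ∧ A.j = J) → B.D + Y n = A.D + X n := by
      intro h
      funext i
      have := hD i
      rw [if_neg h, if_neg h] at this
      simpa using this
    have hclose : ∀ i, |q i (B.h + (B.D + Y n)) - q i (A.h + (A.D + X n))| ≤ 1 := by
      intro i
      refine (hq i).2.2.2 _ _ fun l => ?_
      rw [i2]
      have h3 := hD l
      have h4 := hX1 l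
      have h5 := hY1 l
      simp only [Pi.add_apply] at h3 ⊢
      split_ifs at h3 <;> push_cast <;> omega
    have r1 := hρ A.j (by omega)
    have r2 := hν n (by omega)
    by_cases hc : ∃ i, τ A.j + ρ A.j ≤ q i (A.h + (A.D + X n)) - q i A.h + ν n
    · have hx := hrun_pos hc
      have hcY : ∃ i, τ B.j + ρ' B.j ≤ q i (B.h + (B.D + Y n)) - q i B.h + ν' n := by
        obtain ⟨i, hi⟩ := hc
        refine ⟨i, ?_⟩
        rw [hx] at r2
        simp only at r2
        rw [i1, r1, r2]
        by_cases hAJ : A.j = J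
        · have := abs_le.1 (hclose i)
          rw [← i2] at hi
          simp only [← hA, hAJ, true_and, if_true, and_self] at hi this ⊢
          push_cast
          rw [i2] at this hi ⊢
          linarith [this.1]
        · rw [hsame (by tauto), i2]
          simp only [← hA, hAJ, false_and, if_false]
          simpa using hi
      have hy := hrun_pos hcY
      rw [hx, hy]
      simp only
      refine ⟨by rw [← hA, ← hB, i1], ?_, ?_⟩
      · funext l
        rw [← hA, ← hB, i1, hN _ (by omega) l]
        congr 1
        have := hH l
        by_cases ht : t₀ < n + 1
        · have := hge (by omega)
          have e : J < A.j + 1 := by omega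
          simp only [e, ht, if_true] at *
          omega
        · have := hlt (by omega)
          have e1 : (hrun q τ X ν ρ N (n+1)).j = A.j + 1 := by rw [hx]
          have e : ¬ J < A.j + 1 := by omega
          simp only [e, ht, if_false] at *
          omega
      · intro l
        by_cases ht : t₀ < n + 1
        · have := hge (by omega)
          have e : ¬ A.j + 1 = J := by omega
          simp [← hA, e]
        · simp [ht]
    · have hx := hrun_neg hc
      have hcY : ¬ ∃ i, τ B.j + ρ' B.j ≤ q i (B.h + (B.D + Y n)) - q i B.h + ν' n := by
        rintro ⟨i, hi⟩
        apply hc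
        refine ⟨i, ?_⟩
        rw [hx] at r2
        simp only at r2
        rw [i1, r1, r2] at hi
        have e : ¬ (A.j = J ∧ A.j = J + 1) := by omega
        by_cases hAJ : A.j = J
        · have := abs_le.1 (hclose i)
          simp only [← hA, e, if_false] at hi
          simp only [hAJ, if_true] at hi ⊢
          push_cast at hi
          rw [i2] at this hi
          linarith [this.2]
        · rw [hsame (by tauto), i2] at hi
          simp only [← hA, e, hAJ, if_false] at hi
          simpa using hi
      have hy := hrun_neg hcY
      rw [hx, hy]
      exact ⟨i1, i2, hD⟩
end

lemma q_lip_nat {d : ℕ} {q : (Fin d → ℕ) → ℝ} (hq : MonotoneHistQuery q) (m : ℕ) :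
    ∀ v w : Fin d → ℕ, (∀ i, ((v i : ℤ) - (w i : ℤ)).natAbs ≤ m) → |q v - q w| ≤ m := by
  induction m with
  | zero =>
    intro v w h
    have : v = w := by funext i; have := h i; omega
    simp [this]
  | succ m ih =>
    intro v w h
    let u : Fin d → ℕ := fun i => if v i < w i then w i - 1 else if w i < v i then w i + 1 else w i
    have h1 := ih v u (fun i => by have := h i; simp only [u]; split_ifs <;> omega)
    have h2 := hq.2.2.2 u w (fun i => by simp only [u]; split_ifs <;> omega)
    have := abs_sub_le (q v) (q u) (q w)
    push_cast
    linarith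

lemma q_lip {d : ℕ} {q : (Fin d → ℕ) → ℝ} (hq : MonotoneHistQuery q) (r : ℝ) (hr : 0 ≤ r)
    (v w : Fin d → ℕ) (h : ∀ i, |(v i : ℝ) - w i| ≤ r) : |q v - q w| ≤ r := by
  refine (q_lip_nat hq ⌊r⌋₊ v w fun i => ?_).trans (Nat.floor_le hr)
  apply Nat.le_floor
  rw [Nat.cast_natAbs]
  push_cast
  exact h i

section
variable {d k : ℕ} {q : Fin k → (Fin d → ℕ) → ℝ} {τ : ℕ → ℝ} {X Y : ℕ → Fin d → ℕ}
    {ν ρ ν' ρ' : ℕ → ℤ} {N N' : ℕ → Fin d → ℤ}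

lemma hrun_acc_aux (hq : ∀ i, MonotoneHistQuery (q i)) (T : ℕ) (B : ℝ) (err : ℕ → ℝ)
    (hB : 0 ≤ B) (herr : ∀ j, 0 ≤ err j)
    (hν : ∀ n < T, |(ν n : ℝ)| ≤ B) (hρ : ∀ n < T, |(ρ n : ℝ)| ≤ B)
    (hN : ∀ j, 1 ≤ j → j ≤ T → ∀ i, |(N j i : ℝ)| ≤ err j)
    (hτ : ∀ j, τ j = 2 * err j + 1 + 2 * B) (n : ℕ) (hn : n ≤ T) :
    (∃ b : Fin d → ℕ, b + (hrun q τ X ν ρ N n).D = hcum X n ∧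
      (∀ i, |((hrun q τ X ν ρ N n).h i : ℝ) - b i| ≤ err (hrun q τ X ν ρ N n).j) ∧
      ((hrun q τ X ν ρ N n).j : ℝ) ≤ ∑ i, q i b) ∧
    (∀ i, q i ((hrun q τ X ν ρ N n).h + (hrun q τ X ν ρ N n).D) - q i (hrun q τ X ν ρ N n).h ≤
      τ (hrun q τ X ν ρ N n).j + 2 * B) ∧
    ((hrun q τ X ν ρ N n).j = 0 → (hrun q τ X ν ρ N n).h = fun _ => 0) := by
  induction n with
  | zero =>
    refine ⟨⟨fun _ => 0, ?_, ?_, ?_⟩, ?_, ?_⟩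
    · funext i; simp [hrun, hcum]
    · intro i; simpa [hrun] using herr 0
    · simpa [hrun] using Finset.sum_nonneg fun i _ => (hq i).1 _
    · intro i
      have : (fun _ => 0 : Fin d → ℕ) + (fun _ => 0) = fun _ => 0 := by funext i; simp
      simp only [hrun, this, sub_self, hτ]
      have := herr 0
      linarith
    · intro _; rfl
  | succ n ih =>
    obtain ⟨⟨b, b1, b2, b3⟩, i2, i3⟩ := ih (by omega)
    have hjle : (hrun q τ X ν ρ N n).j ≤ n := hrun_j_le n
    set A := hrun q τ X ν ρ N n with hA
    have b1' : b + (A.D + X n) = hcum X (n+1) := by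
      funext l
      have := congrFun b1 l
      simp only [Pi.add_apply, hcum, Finset.sum_range_succ] at this ⊢
      omega
    have n1 := abs_le.1 (hν n (by omega))
    have n2 := abs_le.1 (hρ A.j (by omega))
    have hE := herr A.j
    by_cases hc : ∃ i, τ A.j + ρ A.j ≤ q i (A.h + (A.D + X n)) - q i A.h + ν n
    · rw [hrun_pos hc]
      simp only [← hA]
      refine ⟨⟨hcum X (n+1), ?_, ?_, ?_⟩, ?_, ?_⟩
      · funext l; simp
      · intro l
        refine le_trans ?_ (hN (A.j+1) (by omega) (by omega) l)
        have : ((((hcum X (n+1) l : ℤ) + N (A.j + 1) l).toNat : ℤ) - (hcum X (n+1) l : ℤ)).natAbs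
          ≤ (N (A.j+1) l).natAbs := by omega
        have h2 : (((((hcum X (n+1) l : ℤ) + N (A.j + 1) l).toNat : ℤ) - (hcum X (n+1) l : ℤ)).natAbs : ℝ)
          ≤ ((N (A.j+1) l).natAbs : ℝ) := by exact_mod_cast this
        rw [Nat.cast_natAbs, Nat.cast_natAbs] at h2
        push_cast at h2
        exact h2
      · obtain ⟨i, hi⟩ := hc
        rw [← b1']
        have e1 := abs_le.1 (q_lip (hq i) _ hE (A.h + (A.D + X n)) (b + (A.D + X n)) (fun l => by
          have := b2 l
          simp only [Pi.add_apply]; push_cast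
          rwa [add_sub_add_right_eq_sub]))
        have e2 := abs_le.1 (q_lip (hq i) _ hE A.h b b2)
        have e3 : q i b + 1 ≤ q i (b + (A.D + X n)) := by
          rw [hτ] at hi
          linarith [e1.1, e1.2, e2.1, e2.2, n1.1, n1.2, n2.1, n2.2]
        have e4 : ∑ l, q l b + 1 ≤ ∑ l, q l (b + (A.D + X n)) := by
          classical
          rw [← Finset.add_sum_erase _ _ (Finset.mem_univ i),
            ← Finset.add_sum_erase _ (fun l => q l (b + (A.D + X n))) (Finset.mem_univ i)]
          have : ∑ l ∈ Finset.univ.erase i, q l b ≤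
              ∑ l ∈ Finset.univ.erase i, q l (b + (A.D + X n)) :=
            Finset.sum_le_sum fun l _ => (hq l).2.2.1 _ _ fun m => by simp
          linarith
        push_cast
        linarith
      · intro i
        have hE' := herr (A.j+1)
        have : ∀ v : Fin d → ℕ, v + (fun _ => 0) = v := fun v => by funext i; simp
        rw [this, sub_self, hτ]
        linarith
      · intro h; omega
    · rw [hrun_neg hc]
      simp only [← hA]
      refine ⟨⟨b, b1', b2, b3⟩, ?_, i3⟩
      intro i
      push Not at hc
      have := hc i
      linarith [n1.1, n2.2]

lemma hrun_acc (hq : ∀ i, MonotoneHistQuery (q i)) (T : ℕ) (B : ℝ) (err : ℕ → ℝ)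
    (hB : 0 ≤ B) (herr : ∀ j, 0 ≤ err j)
    (hν : ∀ n < T, |(ν n : ℝ)| ≤ B) (hρ : ∀ n < T, |(ρ n : ℝ)| ≤ B)
    (hN : ∀ j, 1 ≤ j → j ≤ T → ∀ i, |(N j i : ℝ)| ≤ err j)
    (hτ : ∀ j, τ j = 2 * err j + 1 + 2 * B) (n : ℕ) (hn : n ≤ T) :
    ((hrun q τ X ν ρ N n).j : ℝ) ≤ ∑ i, q i (hcum X n) ∧
    (∀ i, |q i (hrun q τ X ν ρ N n).h - q i (hcum X n)| ≤
      3 * err (hrun q τ X ν ρ N n).j + 1 + 4 * B) ∧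
    ((hrun q τ X ν ρ N n).j = 0 → ∀ i, q i (hrun q τ X ν ρ N n).h = 0) := by
  obtain ⟨⟨b, b1, b2, b3⟩, i2, i3⟩ :=
    hrun_acc_aux (X := X) hq T B err hB herr hν hρ hN hτ n hn
  set A := hrun q τ X ν ρ N n
  refine ⟨?_, ?_, ?_⟩
  · refine b3.trans (Finset.sum_le_sum fun l _ => (hq l).2.2.1 _ _ fun m => ?_)
    rw [← b1]; simp
  · intro i
    have e1 := abs_le.1 (q_lip (hq i) _ (herr A.j) (A.h + A.D) (b + A.D) (fun l => by
          have := b2 l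
          simp only [Pi.add_apply]; push_cast
          rwa [add_sub_add_right_eq_sub]))
    have e2 : q i A.h ≤ q i (A.h + A.D) := (hq i).2.2.1 _ _ fun m => by simp
    have e3 := i2 i
    have := herr A.j
    rw [hτ] at e3
    rw [← b1, abs_le]
    constructor <;> linarith [e1.1, e1.2]
  · intro h i
    rw [i3 h, (hq i).2.1]
end

def dyn (Z : ℕ → ℕ → ℤ) (j : ℕ) : ℤ :=
  ∑ l ∈ Finset.range (Nat.log 2 j),
    ((if j / 2 ^ l % 2 = 1 then Z l (j / 2 ^ l - 1) else 0) + Z l 1)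

lemma two_le_div {j l : ℕ} (hj : 1 ≤ j) (hl : l < Nat.log 2 j) : 2 ≤ j / 2 ^ l := by
  rw [Nat.le_div_iff_mul_le (by positivity)]
  calc 2 * 2 ^ l = 2 ^ (l+1) := by ring
    _ ≤ 2 ^ Nat.log 2 j := Nat.pow_le_pow_right (by norm_num) hl
    _ ≤ j := Nat.pow_log_le_self 2 (by omega)

lemma dyn_shift (Z Z' : ℕ → ℕ → ℤ) (δ : ℤ) (j0 j : ℕ) (hj0 : 1 ≤ j0) (hj : 1 ≤ j)
    (h : ∀ l m, l < j → m ≤ j → Z' l m = Z l m + if m = j0 / 2 ^ l ∧ 1 ≤ m then δ else 0) :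
    dyn Z' j = dyn Z j + if j0 < j then δ else 0 := by
  let g : ℕ → ℤ := fun l => (if j0 / 2 ^ l < j / 2 ^ l then 1 else 0) - (if j0 / 2 ^ l < 1 then 1 else 0)
  have hlog : Nat.log 2 j < j := Nat.log_lt_self 2 (by omega)
  have key : dyn Z' j - dyn Z j = ∑ l ∈ Finset.range (Nat.log 2 j), (δ * g l - δ * g (l+1)) := by
    unfold dyn
    rw [← Finset.sum_sub_distrib]
    refine Finset.sum_congr rfl fun l hl => ?_
    have hl := Finset.mem_range.1 hl
    have h2 := two_le_div hj hl
    have hle : j / 2 ^ l ≤ j := Nat.div_le_self _ _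
    rw [h l 1 (by omega) hj, h l (j / 2 ^ l - 1) (by omega) (by omega)]
    simp only [g, pow_succ, ← Nat.div_div_eq_div_mul]
    generalize j / 2 ^ l = b at *
    generalize j0 / 2 ^ l = a at *
    rw [← mul_sub]
    have : (if a < b then (1:ℤ) else 0) - (if a < 1 then 1 else 0) -
        ((if a / 2 < b / 2 then 1 else 0) - (if a / 2 < 1 then 1 else 0)) =
        (if b % 2 = 1 ∧ b - 1 = a then 1 else 0) + (if 1 = a then 1 else 0) := by
      split_ifs <;> omega
    rw [this]
    have h1 : 1 ≤ b - 1 := by omega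
    by_cases c1 : b % 2 = 1 <;> by_cases c2 : b - 1 = a <;> by_cases c3 : 1 = a <;>
      simp [c1, c2, c3] <;> first | done | omega | (simp_all; try omega)
  rw [Finset.sum_range_sub'] at key
  have e1 : j / 2 ^ Nat.log 2 j = 1 := by
    apply Nat.div_eq_of_lt_le
    · simpa using Nat.pow_log_le_self 2 (by omega)
    · have := Nat.lt_pow_succ_log_self (b := 2) (by norm_num) j
      rw [pow_succ] at this; omega
  have e2 : g (Nat.log 2 j) = 0 := by simp only [g, e1]; simp
  have e3 : g 0 = if j0 < j then 1 else 0 := by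
    simp only [g, pow_zero, Nat.div_one]
    split_ifs <;> omega
  rw [e2, e3] at key
  split_ifs at key ⊢ <;> linarith

lemma dyn_abs (Z : ℕ → ℕ → ℤ) (j : ℕ) : |(dyn Z j : ℝ)| ≤
    ∑ l ∈ Finset.range (Nat.log 2 j), |(Z l (j / 2 ^ l - 1) : ℝ)| +
    ∑ l ∈ Finset.range (Nat.log 2 j), |(Z l 1 : ℝ)| := by
  unfold dyn
  push_cast
  refine (Finset.abs_sum_le_sum_abs _ _).trans ?_
  rw [← Finset.sum_add_distrib]
  refine Finset.sum_le_sum fun l _ => (abs_add_le _ _).trans ?_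
  refine add_le_add ?_ le_rfl
  split_ifs
  · exact le_rfl
  · simp

abbrev NIx (T d : ℕ) := Fin (T+2) ⊕ Fin (T+2) ⊕ (Fin (T+2) × Fin (T+2) × Fin d)

noncomputable def nrate (T d : ℕ) (ε : ℝ) : NIx T d → ℝ
  | .inl _ => ε / 6
  | .inr (.inl _) => ε / 6
  | .inr (.inr (l, m, _)) => ε / (2 * d * ((l.val + Nat.log 2 m.val : ℕ) + 1))

def nnu {T d : ℕ} (ω : NIx T d → ℤ) (n : ℕ) : ℤ := ω (.inl (Fin.ofNat (T+2) n))
def nrho {T d : ℕ} (ω : NIx T d → ℤ) (n : ℕ) : ℤ := ω (.inr (.inl (Fin.ofNat (T+2) n)))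
def nz {T d : ℕ} (ω : NIx T d → ℤ) (i : Fin d) (l m : ℕ) : ℤ :=
  ω (.inr (.inr (Fin.ofNat (T+2) l, Fin.ofNat (T+2) m, i)))
def nN {T d : ℕ} (ω : NIx T d → ℤ) (j : ℕ) (i : Fin d) : ℤ := dyn (nz ω i) (j + 1)

def xs {T d : ℕ} (x : Fin T → Fin d → Bool) (n : ℕ) (i : Fin d) : ℕ :=
  if h : n < T then (if x ⟨n, h⟩ i then 1 else 0) else 0

lemma hcum_xs {T d : ℕ} (x : Fin T → Fin d → Bool) (t : Fin T) :
    hcum (xs x) (t.val + 1) = hist x t := by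
  funext i
  unfold hcum hist
  have h1 : ∑ s : Fin T, (if s ≤ t ∧ x s i then 1 else 0) =
      ∑ s ∈ Finset.range T, if s ≤ t.val then xs x s i else 0 := by
    rw [Finset.sum_range]
    refine Finset.sum_congr rfl fun s _ => ?_
    simp only [xs, s.2, dif_pos, Fin.le_def]
    by_cases h1 : s.val ≤ t.val <;> by_cases h2 : x s i <;> simp [h1, h2]
  rw [h1, ← Finset.sum_filter]
  refine Finset.sum_congr ?_ fun _ _ => rfl
  ext s
  have := t.2
  simp only [Finset.mem_range, Finset.mem_filter]
  omega

/-- noise shift, as a function of the sequence of segment indices -/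
def nshift (T d : ℕ) (js : ℕ → ℕ) (J : ℕ) (δ : Fin d → ℤ) : NIx T d → ℤ
  | .inl n => if n.val < T ∧ js n.val = J ∧ js (n.val+1) = J + 1 then 2 else 0
  | .inr (.inl j) => if j.val = J then 1 else 0
  | .inr (.inr (l, m, i)) => if m.val = (J+1) / 2 ^ l.val ∧ 1 ≤ m.val then δ i else 0

lemma ofNat_val {T n : ℕ} (h : n < T + 2) : (Fin.ofNat (T+2) n).val = n := by
  simp [Fin.ofNat, Nat.mod_eq_of_lt h]

lemma sum_ite_le_of_unique {α : Type*} [Fintype α] (p : α → Prop) [DecidablePred p] (c : ℝ)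
    (hc : 0 ≤ c) (h : ∀ a b, p a → p b → a = b) : ∑ a, (if p a then c else 0) ≤ c := by
  rw [← Finset.sum_filter, Finset.sum_const, nsmul_eq_mul]
  have : (Finset.univ.filter p).card ≤ 1 := Finset.card_le_one.2 fun a ha b hb =>
    h a b (Finset.mem_filter.1 ha).2 (Finset.mem_filter.1 hb).2
  have : ((Finset.univ.filter p).card : ℝ) ≤ 1 := by exact_mod_cast this
  nlinarith

lemma log_div_pow_two (j l : ℕ) (h : 1 ≤ j / 2 ^ l) : l + Nat.log 2 (j / 2 ^ l) = Nat.log 2 j := by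
  have h1 : 2 ^ l ≤ j := by
    by_contra hn
    rw [Nat.div_eq_of_lt (by omega)] at h; omega
  have h2 : l ≤ Nat.log 2 j := Nat.le_log_of_pow_le (by norm_num) h1
  have := Nat.log_div_base_pow 2 j l
  omega

lemma nshift_cost (T d : ℕ) (hd : 1 ≤ d) (ε : ℝ) (hε : 0 < ε) (js : ℕ → ℕ) (hjs : Monotone js) (J : ℕ)
    (δ : Fin d → ℤ) (hδ : ∀ i, |(δ i : ℝ)| ≤ 1) :
    ∑ a, nrate T d ε a * |(nshift T d js J δ a : ℝ)| ≤ ε := by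
  rw [Fintype.sum_sum_type, Fintype.sum_sum_type]
  have hd' : (0:ℝ) < d := by exact_mod_cast hd
  have h1 : ∑ n : Fin (T+2), nrate T d ε (.inl n) * |(nshift T d js J δ (.inl n) : ℝ)| ≤ ε / 3 := by
    have : ∀ n : Fin (T+2), nrate T d ε (.inl n) * |(nshift T d js J δ (.inl n) : ℝ)| =
        if n.val < T ∧ js n.val = J ∧ js (n.val+1) = J + 1 then ε / 3 else 0 := by
      intro n
      simp only [nrate, nshift]
      split_ifs
      · norm_num; ring
      · simp
    simp_rw [this]
    refine sum_ite_le_of_unique _ _ (by positivity) ?_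
    rintro a b ⟨-, a1, a2⟩ ⟨-, b1, b2⟩
    rcases lt_trichotomy a.val b.val with h | h | h
    · have := hjs (by omega : a.val + 1 ≤ b.val); omega
    · exact Fin.ext h
    · have := hjs (by omega : b.val + 1 ≤ a.val); omega
  have h2 : ∑ n : Fin (T+2), nrate T d ε (.inr (.inl n)) * |(nshift T d js J δ (.inr (.inl n)) : ℝ)|
      ≤ ε / 6 := by
    have : ∀ n : Fin (T+2), nrate T d ε (.inr (.inl n)) * |(nshift T d js J δ (.inr (.inl n)) : ℝ)| =
        if n.val = J then ε / 6 else 0 := by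
      intro n
      simp only [nrate, nshift]
      split_ifs <;> simp
    simp_rw [this]
    refine sum_ite_le_of_unique _ _ (by positivity) ?_
    intro a b h h'
    exact Fin.ext (by omega)
  have h3 : ∑ n : Fin (T+2) × Fin (T+2) × Fin d,
      nrate T d ε (.inr (.inr n)) * |(nshift T d js J δ (.inr (.inr n)) : ℝ)| ≤ ε / 2 := by
    set e := Nat.log 2 (J+1) with he
    set c : ℝ := ε / (2 * d * ((e:ℝ) + 1)) with hc
    have hc0 : 0 < c := by positivity
    have : ∀ n : Fin (T+2) × Fin (T+2) × Fin d,
        nrate T d ε (.inr (.inr n)) * |(nshift T d js J δ (.inr (.inr n)) : ℝ)| ≤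
        if n.2.1.val = (J+1) / 2 ^ n.1.val ∧ 1 ≤ n.2.1.val then c else 0 := by
      rintro ⟨l, m, i⟩
      simp only [nrate, nshift]
      split_ifs with h
      · have : l.val + Nat.log 2 m.val = e := by
          rw [h.1]; exact log_div_pow_two _ _ (by rw [← h.1]; exact h.2)
        rw [this, ← hc]
        have := hδ i
        nlinarith
      · simp
    refine (Finset.sum_le_sum fun n _ => this n).trans ?_
    rw [← Finset.sum_filter, Finset.sum_const, nsmul_eq_mul]
    have hcard : (Finset.univ.filter (fun n : Fin (T+2) × Fin (T+2) × Fin d =>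
        n.2.1.val = (J+1) / 2 ^ n.1.val ∧ 1 ≤ n.2.1.val)).card ≤
        (Finset.range (e+1) ×ˢ (Finset.univ : Finset (Fin d))).card := by
      refine Finset.card_le_card_of_injOn (fun n => (n.1.val, n.2.2)) ?_ ?_
      · rintro ⟨l, m, i⟩ h
        simp only [Finset.coe_filter, Finset.mem_univ, true_and] at h
        have h : m.val = (J+1) / 2 ^ l.val ∧ 1 ≤ m.val := h
        have := log_div_pow_two (J+1) l.val (by rw [← h.1]; exact h.2)
        simp only [Finset.coe_product, Finset.coe_range, Finset.coe_univ, Set.mem_prod,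
          Set.mem_Iio, Set.mem_univ, and_true]
        omega
      · rintro ⟨l, m, i⟩ h ⟨l', m', i'⟩ h' heq
        have h : m.val = (J+1) / 2 ^ l.val ∧ 1 ≤ m.val := (Finset.mem_filter.1 h).2
        have h' : m'.val = (J+1) / 2 ^ l'.val ∧ 1 ≤ m'.val := (Finset.mem_filter.1 h').2
        simp only [Prod.mk.injEq] at heq
        obtain ⟨e1, e2⟩ := heq
        have e1 : l = l' := Fin.ext e1
        subst e1
        have : m = m' := Fin.ext (by omega)
        subst this
        rw [e2]
    rw [Finset.card_product, Finset.card_range, Finset.card_univ, Fintype.card_fin] at hcard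
    have hcard' : ((Finset.univ.filter (fun n : Fin (T+2) × Fin (T+2) × Fin d =>
        n.2.1.val = (J+1) / 2 ^ n.1.val ∧ 1 ≤ n.2.1.val)).card : ℝ) ≤ ((e:ℝ)+1) * d := by
      exact_mod_cast hcard
    calc _ ≤ ((e:ℝ)+1) * d * c := by gcongr
      _ = ε / 2 := by rw [hc]; field_simp
  linarith

noncomputable def nout {d k T : ℕ} (q : Fin k → (Fin d → ℕ) → ℝ) (τ : ℕ → ℝ)
    (x : Fin T → Fin d → Bool) (ω : NIx T d → ℤ) : ℕ → HSt d :=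
  hrun q τ (xs x) (nnu ω) (nrho ω) (nN ω)

lemma nout_dp {d k T : ℕ} (hd : 1 ≤ d) (q : Fin k → (Fin d → ℕ) → ℝ)
    (hq : ∀ i, MonotoneHistQuery (q i)) (τ : ℕ → ℝ) (ε : ℝ) (hε : 0 < ε)
    (μ : NIx T d → Measure ℤ) [∀ i, IsProbabilityMeasure (μ i)]
    (h : ∀ i, ∀ z s : ℤ, μ i {z} ≤ ENNReal.ofReal (Real.exp (nrate T d ε i * |(s:ℝ)|)) * μ i {z + s}) :
    IsEventDP ε (fun x : Fin T → Fin d → Bool => (Measure.pi μ).map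
      (fun ω (t : Fin T) (i : Fin k) => q i (nout q τ x ω (t.val+1)).h)) := by
  rintro x y ⟨t₀, ht⟩ S hS
  simp only
  rw [Measure.map_apply .of_discrete hS, Measure.map_apply .of_discrete hS]
  let s : (NIx T d → ℤ) → NIx T d → ℤ := fun ω =>
    nshift T d (fun n => (nout q τ x ω n).j) (nout q τ x ω t₀).j
      (fun i => (xs x t₀ i : ℤ) - xs y t₀ i)
  have hx1 : ∀ (x : Fin T → Fin d → Bool) i, xs x t₀ i ≤ 1 := by
    intro x i; unfold xs; split_ifs <;> omega
  have hcoup : ∀ ω, ∀ n ≤ T, (nout q τ y (ω + s ω) n).j = (nout q τ x ω n).j ∧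
      (nout q τ y (ω + s ω) n).h = (nout q τ x ω n).h := by
    intro ω n hn
    have hJT : (nout q τ x ω t₀).j ≤ t₀ := hrun_j_le _
    have ht₀ := t₀.2
    have := hrun_coupling (q := q) (τ := τ) (X := xs x) (Y := xs y) (ν := nnu ω) (ρ := nrho ω)
      (N := nN ω) (ν' := nnu (ω + s ω)) (ρ' := nrho (ω + s ω)) (N' := nN (ω + s ω)) hq T t₀
      ?_ (hx1 x) (hx1 y) (nout q τ x ω t₀).j rfl ?_ ?_ ?_ n hn
    · exact ⟨this.1, this.2.1⟩
    · intro m hm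
      funext i
      unfold xs
      split_ifs with h
      all_goals first | rfl | (have := ht ⟨m, h⟩ (fun e => hm (by rw [← e])); simp_all)
    · intro j hj
      simp only [nrho, Pi.add_apply, s, nshift, ofNat_val (show j < T + 2 by omega)]
    · intro m hm
      simp only [nnu, Pi.add_apply, s, nshift, ofNat_val (show m < T + 2 by omega), hm, true_and]
      rfl
    · intro j hj i
      unfold nN
      have := dyn_shift (nz ω i) (nz (ω + s ω) i) ((xs x t₀ i : ℤ) - xs y t₀ i)
        ((nout q τ x ω t₀).j + 1) (j+1) (by omega) (by omega) ?_
      · rw [this]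
        simp
      · intro l m hl hm
        simp only [nz, Pi.add_apply, s, nshift, ofNat_val (show l < T + 2 by omega),
          ofNat_val (show m < T + 2 by omega)]
  have hscongr : ∀ ω ω', (∀ n ≤ T, (nout q τ x ω n).j = (nout q τ x ω' n).j) → s ω = s ω' := by
    intro ω ω' h
    have ht₀ := t₀.2
    funext a
    rcases a with n | n | ⟨l, m, i⟩
    · simp only [s, nshift]
      by_cases hn : n.val < T
      · rw [h t₀ (by omega), h n.val (by omega), h (n.val+1) (by omega)]
      · simp [hn]
    · simp only [s, nshift]
      rw [h t₀ (by omega)]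
    · simp only [s, nshift]
      rw [h t₀ (by omega)]
  refine coupling_le _ _ _ _ (fun ω => ω + s ω) ?_ ?_ ?_ S
  · intro ω ω' he
    simp only at he
    have : s ω = s ω' := by
      apply hscongr
      intro n hn
      rw [← (hcoup ω n hn).1, ← (hcoup ω' n hn).1, he]
    rw [this] at he
    exact add_right_cancel he
  · intro ω
    funext t i
    rw [(hcoup ω (t.val+1) t.2).2]
  · intro ω
    refine pi_shift_le μ _ h ε (s ω) ?_ ω
    refine nshift_cost T d hd ε hε _ hrun_j_mono _ _ ?_
    intro i
    have h1 := hx1 x i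
    have h2 := hx1 y i
    have h1' : (xs x t₀ i : ℝ) ≤ 1 := by exact_mod_cast h1
    have h2' : (xs y t₀ i : ℝ) ≤ 1 := by exact_mod_cast h2
    have h3 : (0:ℝ) ≤ xs x t₀ i := by positivity
    have h4 : (0:ℝ) ≤ xs y t₀ i := by positivity
    push_cast
    rw [abs_le]; constructor <;> linarith

def nA1 (T d : ℕ) (j : ℕ) (i : Fin d) : Finset (NIx T d) :=
  (Finset.range (Nat.log 2 (j+1))).image
    (fun l => Sum.inr (Sum.inr (Fin.ofNat (T+2) l, Fin.ofNat (T+2) ((j+1) / 2 ^ l - 1), i)))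
def nA2 (T d : ℕ) (j : ℕ) (i : Fin d) : Finset (NIx T d) :=
  (Finset.range (Nat.log 2 (j+1))).image
    (fun l => Sum.inr (Sum.inr (Fin.ofNat (T+2) l, Fin.ofNat (T+2) 1, i)))

lemma nA_card (T d j : ℕ) (i : Fin d) : (nA1 T d j i ∪ nA2 T d j i).card ≤ 2 * Nat.log 2 (j+1) := by
  refine (Finset.card_union_le _ _).trans ?_
  have h1 : (nA1 T d j i).card ≤ _ := Finset.card_image_le
  have h2 : (nA2 T d j i).card ≤ _ := Finset.card_image_le
  rw [Finset.card_range] at h1 h2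
  omega

lemma log_sum_le {j l m : ℕ} (hl : l < Nat.log 2 (j+1)) (hm : m ≤ (j+1)/2^l) :
    l + Nat.log 2 m ≤ Nat.log 2 (j+1) := by
  have h2 := two_le_div (by omega : 1 ≤ j + 1) hl
  have := log_div_pow_two (j+1) l (by omega)
  have := Nat.log_mono_right (b := 2) hm
  omega

lemma nrate_pos (T d : ℕ) (hd : 1 ≤ d) (ε : ℝ) (hε : 0 < ε) (a : NIx T d) : 0 < nrate T d ε a := by
  have hd' : (0:ℝ) < d := by exact_mod_cast hd
  rcases a with n | n | ⟨l, m, i⟩ <;> simp only [nrate] <;> positivity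

lemma nN_bound {T d : ℕ} (hd : 1 ≤ d) (ε : ℝ) (hε : 0 < ε) (ω : NIx T d → ℤ) (j : ℕ) (hj : j ≤ T)
    (i : Fin d) (s : ℝ)
    (h : ∑ a ∈ nA1 T d j i ∪ nA2 T d j i, nrate T d ε a * |(ω a : ℝ)| ≤ s) :
    |(nN ω j i : ℝ)| ≤ s * (4 * d * ((Nat.log 2 (j+1) : ℕ) + 1)) / ε := by
  have hd' : (0:ℝ) < d := by exact_mod_cast hd
  set e := Nat.log 2 (j+1) with he
  have helt : e < j + 1 := Nat.log_lt_self 2 (by omega)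
  set c : ℝ := ε / (2 * d * ((e:ℝ) + 1)) with hc
  have hc0 : 0 < c := by positivity
  have hrate : ∀ l m : ℕ, l < e → m ≤ (j+1)/2^l → c ≤ nrate T d ε
      (Sum.inr (Sum.inr (Fin.ofNat (T+2) l, Fin.ofNat (T+2) m, i))) := by
    intro l m hl hm
    have : (j+1)/2^l ≤ j+1 := Nat.div_le_self _ _
    simp only [nrate]
    rw [ofNat_val (by omega), ofNat_val (by omega), hc]
    have := log_sum_le hl hm
    gcongr
  have hsub : ∀ A : Finset (NIx T d), A ⊆ nA1 T d j i ∪ nA2 T d j i →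
      ∑ a ∈ A, nrate T d ε a * |(ω a : ℝ)| ≤ s := fun A hA =>
    (Finset.sum_le_sum_of_subset_of_nonneg hA fun a _ _ =>
      mul_nonneg (nrate_pos T d hd ε hε a).le (abs_nonneg _)).trans h
  have h1 := hsub _ Finset.subset_union_left
  have h2 := hsub _ Finset.subset_union_right
  unfold nA1 at h1
  unfold nA2 at h2
  have hinj : ∀ f : ℕ → Fin (T+2), Set.InjOn (fun l => (Sum.inr (Sum.inr (Fin.ofNat (T+2) l, f l, i)) : NIx T d))
      (Finset.range (Nat.log 2 (j+1)) : Finset ℕ) := by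
    intro f a ha b hb hab
    have ha := Finset.mem_range.1 (Finset.mem_coe.1 ha)
    have hb := Finset.mem_range.1 (Finset.mem_coe.1 hb)
    simp only [Sum.inr.injEq, Prod.mk.injEq] at hab
    have := congrArg Fin.val hab.1
    rwa [ofNat_val (by omega), ofNat_val (by omega)] at this
  rw [Finset.sum_image (hinj _)] at h1 h2
  have k1 : c * ∑ l ∈ Finset.range e, |(nz ω i l ((j+1) / 2 ^ l - 1) : ℝ)| ≤ s := by
    refine le_trans ?_ h1
    rw [Finset.mul_sum]
    refine Finset.sum_le_sum fun l hl => ?_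
    exact mul_le_mul_of_nonneg_right (hrate _ _ (Finset.mem_range.1 hl) (Nat.sub_le _ _)) (abs_nonneg _)
  have k2 : c * ∑ l ∈ Finset.range e, |(nz ω i l 1 : ℝ)| ≤ s := by
    refine le_trans ?_ h2
    rw [Finset.mul_sum]
    refine Finset.sum_le_sum fun l hl => ?_
    have := two_le_div (by omega : 1 ≤ j + 1) (Finset.mem_range.1 hl)
    exact mul_le_mul_of_nonneg_right (hrate _ _ (Finset.mem_range.1 hl) (by omega)) (abs_nonneg _)
  have k3 := dyn_abs (nz ω i) (j+1)
  have e1 : s * (4 * d * ((e:ℝ) + 1)) / ε = 2 * s / c := by rw [hc]; field_simp; ring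
  rw [e1, le_div_iff₀ hc0]
  unfold nN
  calc _ ≤ (∑ l ∈ Finset.range e, |(nz ω i l ((j+1) / 2 ^ l - 1) : ℝ)| + ∑ l ∈ Finset.range e, |(nz ω i l 1 : ℝ)|) * c := by gcongr
    _ ≤ 2 * s := by linarith

noncomputable def nB (T : ℕ) (ε β : ℝ) : ℝ := 2 * Real.log (6 * T / β) * 6 / ε
noncomputable def ns (d : ℕ) (β : ℝ) (j : ℕ) : ℝ := 2 * Real.log (3 * d * ((j:ℝ)+1)^4 / β)
noncomputable def nerr (d : ℕ) (ε β : ℝ) (j : ℕ) : ℝ :=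
  ns d β j * (4 * d * ((Nat.log 2 (j+1) : ℕ) + 1)) / ε

lemma ns_nonneg (d : ℕ) (hd : 1 ≤ d) (β : ℝ) (hβ : β ∈ Set.Ioo (0:ℝ) 1) (j : ℕ) : 0 ≤ ns d β j := by
  have hd' : (1:ℝ) ≤ d := by exact_mod_cast hd
  refine mul_nonneg (by norm_num) (Real.log_nonneg ?_)
  rw [le_div_iff₀ hβ.1]
  have : (1:ℝ) ≤ ((j:ℝ)+1)^4 := one_le_pow₀ (by linarith [Nat.cast_nonneg (α := ℝ) j])
  nlinarith [hβ.2]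

lemma nB_nonneg (T : ℕ) (hT : 1 ≤ T) (ε β : ℝ) (hε : 0 < ε) (hβ : β ∈ Set.Ioo (0:ℝ) 1) : 0 ≤ nB T ε β := by
  have hT' : (1:ℝ) ≤ T := by exact_mod_cast hT
  have : 0 ≤ Real.log (6 * T / β) := by
    refine Real.log_nonneg ?_
    rw [le_div_iff₀ hβ.1]
    linarith [hβ.2]
  unfold nB; positivity

lemma sum_inv_sq (T : ℕ) : ∑ j ∈ Finset.range T, (1:ℝ) / ((j:ℝ)+2)^2 ≤ 1 - 1/((T:ℝ)+1) := by
  induction T with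
  | zero => simp
  | succ n ih =>
    rw [Finset.sum_range_succ]
    have : (1:ℝ) / ((n:ℝ)+2)^2 ≤ 1/((n:ℝ)+1) - 1/((n:ℝ)+2) := by
      rw [div_sub_div _ _ (by positivity) (by positivity), div_le_div_iff₀ (by positivity) (by positivity)]
      have : (0:ℝ) ≤ n := by positivity
      nlinarith
    push_cast
    have e : (n:ℝ) + 1 + 1 = n + 2 := by ring
    rw [e]; linarith

/-- the event of bad noise -/
def nbad (T d : ℕ) (ε β : ℝ) : Set (NIx T d → ℤ) :=
  (⋃ n : Fin T, {ω | 2 * Real.log (6 * T / β) < ∑ a ∈ {(Sum.inl (Fin.ofNat (T+2) n.val) : NIx T d)}, nrate T d ε a * |(ω a : ℝ)|}) ∪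
  ((⋃ n : Fin T, {ω | 2 * Real.log (6 * T / β) < ∑ a ∈ {(Sum.inr (Sum.inl (Fin.ofNat (T+2) n.val)) : NIx T d)}, nrate T d ε a * |(ω a : ℝ)|}) ∪
  (⋃ p : Fin T × Fin d, {ω | ns d β (p.1.val+1) < ∑ a ∈ nA1 T d (p.1.val+1) p.2 ∪ nA2 T d (p.1.val+1) p.2, nrate T d ε a * |(ω a : ℝ)|}))

lemma union_bound {Ω ι : Type*} [MeasurableSpace Ω] [Fintype ι] (P : Measure Ω) (E : ι → Set Ω) (b : ι → ℝ)
    (hb : ∀ i, 0 ≤ b i) (h : ∀ i, P (E i) ≤ ENNReal.ofReal (b i)) :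
    P (⋃ i, E i) ≤ ENNReal.ofReal (∑ i, b i) := by
  rw [ENNReal.ofReal_sum_of_nonneg fun i _ => hb i]
  exact (measure_iUnion_fintype_le P E).trans (Finset.sum_le_sum fun i _ => h i)

lemma nbad_prob {T d : ℕ} (hT : 1 ≤ T) (hd : 1 ≤ d) (ε β : ℝ) (hβ : β ∈ Set.Ioo (0:ℝ) 1)
    (μ : NIx T d → Measure ℤ) [∀ i, IsProbabilityMeasure (μ i)]
    (h : ∀ i, ∫⁻ z, ENNReal.ofReal (Real.exp (nrate T d ε i * |(z:ℝ)| / 2)) ∂(μ i) ≤ 2) :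
    Measure.pi μ (nbad T d ε β) ≤ ENNReal.ofReal β := by
  have hT' : (0:ℝ) < T := by exact_mod_cast hT
  have hd' : (0:ℝ) < d := by exact_mod_cast hd
  have hβ0 := hβ.1
  have hex : ∀ y : ℝ, 0 < y → Real.exp (-(2 * Real.log y) / 2) = y⁻¹ := by
    intro y hy
    rw [show -(2 * Real.log y) / 2 = - Real.log y by ring, Real.exp_neg, Real.exp_log hy]
  have hsing : ∀ a : NIx T d, Measure.pi μ {ω | 2 * Real.log (6 * T / β) < ∑ a ∈ {a}, nrate T d ε a * |(ω a : ℝ)|} ≤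
      ENNReal.ofReal (β / (3 * T)) := by
    intro a
    refine (pi_tail μ _ h {a} _).trans (ENNReal.ofReal_le_ofReal ?_)
    rw [hex _ (by positivity), Finset.card_singleton]
    apply le_of_eq; field_simp; norm_num
  have hsumT : ∑ _n : Fin T, β / (3 * T) = β / 3 := by
    rw [Finset.sum_const, Finset.card_univ, Fintype.card_fin, nsmul_eq_mul]; field_simp
  have h1 := union_bound (Measure.pi μ) _ (fun _ : Fin T => β / (3 * T)) (fun _ => by positivity)
    (fun n => hsing (Sum.inl (Fin.ofNat (T+2) n.val)))
  have h2 := union_bound (Measure.pi μ) _ (fun _ : Fin T => β / (3 * T)) (fun _ => by positivity)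
    (fun n => hsing (Sum.inr (Sum.inl (Fin.ofNat (T+2) n.val))))
  have h3 := union_bound (Measure.pi μ) (fun p : Fin T × Fin d => {ω | ns d β (p.1.val+1) < ∑ a ∈ nA1 T d (p.1.val+1) p.2 ∪ nA2 T d (p.1.val+1) p.2, nrate T d ε a * |(ω a : ℝ)|})
    (fun p => β / (3 * d) * (1 / ((p.1.val:ℝ)+2)^2)) (fun _ => by positivity) (by
      intro p
      refine (pi_tail μ _ h _ _).trans (ENNReal.ofReal_le_ofReal ?_)
      unfold ns
      rw [hex _ (by positivity)]
      have hc : ((2:ℝ) ^ (nA1 T d (p.1.val+1) p.2 ∪ nA2 T d (p.1.val+1) p.2).card) ≤ ((p.1.val:ℝ)+2)^2 := by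
        refine (pow_le_pow_right₀ (by norm_num) (nA_card _ _ _ _)).trans ?_
        rw [mul_comm, pow_mul]
        have := Nat.pow_log_le_self 2 (x := p.1.val+1+1) (by omega)
        have h' : ((2:ℝ) ^ Nat.log 2 (p.1.val+1+1)) ≤ (p.1.val:ℝ)+2 := by
          have : ((2 ^ Nat.log 2 (p.1.val+1+1) : ℕ) : ℝ) ≤ ((p.1.val+1+1 : ℕ) : ℝ) := by exact_mod_cast this
          push_cast at this; linarith
        gcongr
      push_cast
      calc _ ≤ ((p.1.val:ℝ)+2)^2 * (3 * d * ((p.1.val:ℝ)+1+1)^4 / β)⁻¹ := by gcongr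
        _ = _ := by
          have : (p.1.val:ℝ)+1+1 = (p.1.val:ℝ)+2 := by ring
          rw [this]; field_simp)
  have hsum3 : ∑ p : Fin T × Fin d, β / (3 * d) * (1 / ((p.1.val:ℝ)+2)^2) ≤ β / 3 := by
    rw [Fintype.sum_prod_type]
    simp only [Finset.sum_const, Finset.card_univ, Fintype.card_fin, nsmul_eq_mul]
    rw [← Finset.mul_sum, ← Finset.mul_sum, ← Finset.sum_range (fun n => 1 / ((n:ℝ)+2)^2)]
    have := sum_inv_sq T
    have h0 : (0:ℝ) ≤ 1 / ((T:ℝ)+1) := by positivity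
    calc _ ≤ (d:ℝ) * (β / (3 * d) * 1) := by gcongr; linarith
      _ = β / 3 := by field_simp
  rw [hsumT] at h1 h2
  replace h3 := h3.trans (ENNReal.ofReal_le_ofReal hsum3)
  refine (measure_union_le _ _).trans ?_
  refine (add_le_add h1 ((measure_union_le _ _).trans (add_le_add h2 h3))).trans ?_
  rw [← ENNReal.ofReal_add (by positivity) (by positivity), ← ENNReal.ofReal_add (by positivity) (by positivity)]
  apply ENNReal.ofReal_le_ofReal; linarith

lemma q_le_cmax {d k T : ℕ} (q : Fin k → (Fin d → ℕ) → ℝ)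
    (x : Fin T → Fin d → Bool) (i : Fin k) (t : Fin T) : q i (hist x t) ≤ cmax q x := by
  unfold cmax
  exact (le_ciSup (f := fun t => q i (hist x t)) (Set.finite_range _).bddAbove t).trans
    (le_ciSup (f := fun i => ⨆ t, q i (hist x t)) (Set.finite_range _).bddAbove i)

lemma regimeB (ε β : ℝ) (d k T : ℕ) (hε : 0 < ε) (hβ : β ∈ Set.Ioo (0 : ℝ) 1)
    (hd : 1 ≤ d) (hT : 1 ≤ T) (q : Fin k → (Fin d → ℕ) → ℝ) (hq : ∀ i, MonotoneHistQuery (q i)) :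
    ∃ M : (Fin T → Fin d → Bool) → Measure (Fin T → Fin k → ℝ),
          IsCOMech M ∧ IsEventDP ε M ∧
          ∀ x, ENNReal.ofReal (1 - β) ≤
            M x {a | ∀ (t : Fin T) (i : Fin k), ∃ j : ℕ, (j:ℝ) ≤ k * cmax q x ∧
              |a t i - q i (hist x t)| ≤ 3 * nerr d ε β j + 1 + 4 * nB T ε β ∧
              (j = 0 → |a t i - q i (hist x t)| ≤ cmax q x)} := by
  have hdl := fun i => exists_dlap (nrate T d ε i) (nrate_pos T d hd ε hε i)
  choose μ hμ h1 h2 using hdl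
  let τ : ℕ → ℝ := fun j => 2 * nerr d ε β j + 1 + 2 * nB T ε β
  refine ⟨_, ?_, nout_dp hd q hq τ ε hε μ h1, ?_⟩
  · refine comech_of_causal (Measure.pi μ) (fun x ω (t : Fin T) (i : Fin k) => q i (nout q τ x ω (t.val+1)).h) ?_
    intro t x y h ω
    have : nout q τ x ω (t.val+1) = nout q τ y ω (t.val+1) := by
      apply hrun_congr
      intro s hs
      funext i
      have := t.2
      simp only [xs, show s < T by omega, dif_pos]
      rw [h ⟨s, by omega⟩ (by rw [Fin.le_def]; simp; omega)]
    simp only [this]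
  · intro x
    refine le_trans ?_ (Measure.le_map_apply (Measurable.of_discrete).aemeasurable _)
    refine prob_ge_of_compl _ _ (nbad T d ε β) β ?_ (nbad_prob hT hd ε β hβ μ h2) hβ.1.le
    rw [Set.compl_subset_comm]
    intro ω hω
    simp only [nbad, Set.mem_compl_iff, Set.mem_union, Set.mem_iUnion, not_or, not_exists,
      Set.mem_ofPred_eq, not_lt, Finset.sum_singleton] at hω
    obtain ⟨w1, w2, w3⟩ := hω
    have hB := nB_nonneg T hT ε β hε hβ
    have herr : ∀ j, 0 ≤ nerr d ε β j := by
      intro j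
      have := ns_nonneg d hd β hβ j
      unfold nerr; positivity
    intro t i
    have key := hrun_acc (X := xs x) (τ := τ) (ν := nnu ω) (ρ := nrho ω) (N := nN ω) hq T (nB T ε β) (nerr d ε β) hB herr ?_ ?_ ?_ (fun _ => rfl)
      (t.val+1) t.2
    · rw [hcum_xs] at key
      obtain ⟨k1, k2, k3⟩ := key
      refine ⟨_, ?_, k2 i, ?_⟩
      · refine k1.trans ((Finset.sum_le_sum fun i _ => q_le_cmax q x i t).trans ?_)
        simp
      · intro h0
        have hh := k3 h0 i
        have hge := (hq i).1 (hist x t)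
        change |q i (hrun q τ (xs x) (nnu ω) (nrho ω) (nN ω) (t.val+1)).h - _| ≤ _
        rw [hh, zero_sub, abs_neg, abs_of_nonneg hge]
        exact q_le_cmax q x i t
    · intro n hn
      have := w1 ⟨n, hn⟩
      simp only [nrate] at this
      unfold nB nnu
      rw [le_div_iff₀ hε]; linarith
    · intro n hn
      have := w2 ⟨n, hn⟩
      simp only [nrate] at this
      unfold nB nrho
      rw [le_div_iff₀ hε]; linarith
    · intro j hj1 hj2 l
      have := w3 (⟨j-1, by omega⟩, l)
      simp only [Nat.sub_add_cancel hj1] at this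
      exact nN_bound hd ε hε ω j hj2 l _ this

lemma log2c_ge_one (z : ℝ) : 1 ≤ log2c z := by
  unfold log2c
  rw [Real.le_logb_iff_rpow_le (by norm_num) (by positivity)]
  simp

lemma log_le_log2c (z y : ℝ) (hy : 0 < y) (h : y ≤ max z 2) : Real.log y ≤ log2c z := by
  have h1 := log2c_ge_one z
  have h2 : Real.log (max z 2) = log2c z * Real.log 2 := by
    unfold log2c Real.logb
    have : Real.log 2 ≠ 0 := by have := Real.log_two_gt_d9; linarith
    field_simp
  have h3 := Real.log_le_log hy h
  have := Real.log_two_lt_d9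
  nlinarith

set_option maxHeartbeats 2000000 in
lemma final_ineq (ε β c E : ℝ) (d k T j : ℕ) (hε : 0 < ε) (hβ : β ∈ Set.Ioo (0 : ℝ) 1)
    (hd : 1 ≤ d) (hk : 1 ≤ k) (hT : 1 ≤ T) (hc : 0 ≤ c)
    (hreg : β < (T : ℝ) * (2 ^ d * Real.exp (-ε))) (hj : (j:ℝ) ≤ k * c)
    (hE : E ≤ 3 * nerr d ε β j + 1 + 4 * nB T ε β) (hE0 : j = 0 → E ≤ c) :
    E ≤ 1000 * ε⁻¹ * ((d : ℝ) * (log2c ((d : ℝ) * k * c / β)) ^ 2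
                  + (k : ℝ) * log2c ((k : ℝ) * c / β) + log2c (T : ℝ)) := by
  have hd' : (1:ℝ) ≤ d := by exact_mod_cast hd
  have hk' : (1:ℝ) ≤ k := by exact_mod_cast hk
  have hT' : (1:ℝ) ≤ T := by exact_mod_cast hT
  obtain ⟨hβ0, hβ1⟩ := hβ
  set l := log2c ((d : ℝ) * k * c / β) with hl
  set l' := log2c ((k : ℝ) * c / β) with hl'
  set lT := log2c (T : ℝ) with hlT
  have l1 : 1 ≤ l := log2c_ge_one _
  have l1' : 1 ≤ l' := log2c_ge_one _
  have lT1 : 1 ≤ lT := log2c_ge_one _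
  have hlnT : Real.log T ≤ lT := log_le_log2c _ _ (by linarith) (le_max_left _ _)
  have hkl : 0 ≤ (k:ℝ) * l' := by positivity
  have hll : l ≤ l ^ 2 := by nlinarith
  have hdl : l ^ 2 ≤ d * l ^ 2 := by nlinarith [sq_nonneg l]
  have hdd : (d:ℝ) ≤ d * l ^ 2 := by nlinarith
  have hεb : ε ≤ lT + d - Real.log β := by
    have h1 := Real.log_lt_log hβ0 hreg
    rw [Real.log_mul (by positivity) (by positivity), Real.log_mul (by positivity) (by positivity),
      Real.log_exp, Real.log_pow] at h1
    have := Real.log_two_lt_d9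
    nlinarith
  rw [mul_assoc, mul_comm ε⁻¹, ← mul_assoc, ← div_eq_mul_inv]
  set V := max ((d : ℝ) * k * c / β) 2 with hV
  have hV2 : 2 ≤ V := le_max_right _ _
  have hVQ : (d : ℝ) * k * c / β ≤ V := le_max_left _ _
  have hVl : Real.log V ≤ l := log_le_log2c _ _ (by linarith) le_rfl
  by_cases hkc : 1 ≤ (k:ℝ) * c
  · have hQ : (d : ℝ) * (k * c) ≤ V * β := by
      rw [div_le_iff₀ hβ0] at hVQ; linarith
    have hkcV : (k:ℝ) * c ≤ V := by nlinarith
    have hβV : 1 / β ≤ V := by rw [div_le_iff₀ hβ0]; nlinarith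
    have hlnβ : - Real.log β ≤ l := by
      refine le_trans ?_ hVl
      rw [← Real.log_inv, ← one_div]
      exact Real.log_le_log (by positivity) hβV
    have hj1 : (j:ℝ) + 1 ≤ 2 * (k * c) := by linarith
    have hns : ns d β j ≤ 20 * l := by
      unfold ns
      have : 3 * d * ((j:ℝ)+1)^4 / β ≤ V ^ 10 := by
        rw [div_le_iff₀ hβ0]
        calc 3 * d * ((j:ℝ)+1)^4 ≤ 3 * d * (2 * (k * c))^4 := by gcongr
          _ = 48 * (k*c)^3 * (d * (k * c)) := by ring
          _ ≤ 64 * V^3 * (V * β) := by gcongr; norm_num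
          _ = 2 ^ 6 * V ^ 4 * β := by ring
          _ ≤ V ^ 6 * V ^ 4 * β := by gcongr
          _ = V ^ 10 * β := by ring
      have := Real.log_le_log (by positivity) this
      rw [Real.log_pow] at this
      push_cast at this
      linarith
    have hns0 : 0 ≤ ns d β j := ns_nonneg d hd β ⟨hβ0, hβ1⟩ j
    have he : ((Nat.log 2 (j+1) : ℕ) : ℝ) + 1 ≤ 3 * l := by
      have h1 : ((2:ℝ) ^ Nat.log 2 (j+1)) ≤ V ^ 2 := by
        have := Nat.pow_log_le_self 2 (x := j+1) (by omega)
        have : ((2 ^ Nat.log 2 (j+1) : ℕ) : ℝ) ≤ ((j+1 : ℕ) : ℝ) := by exact_mod_cast this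
        push_cast at this
        nlinarith
      have h2 : Real.logb 2 ((2:ℝ) ^ Nat.log 2 (j+1)) ≤ Real.logb 2 (V ^ 2) :=
        Real.logb_le_logb_of_le (by norm_num) (by positivity) h1
      rw [Real.logb_pow, Real.logb_pow, Real.logb_self_eq_one (by norm_num)] at h2
      have : Real.logb 2 V = l := rfl
      rw [this] at h2
      push_cast at h2
      linarith
    have herr : nerr d ε β j ≤ 240 * (d * l ^ 2) / ε := by
      unfold nerr
      rw [div_le_div_iff_of_pos_right hε]
      calc _ ≤ 20 * l * (4 * d * (3 * l)) := by gcongr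
        _ = _ := by ring
    have hB : nB T ε β ≤ 12 * (2 + lT + l) / ε := by
      unfold nB
      rw [div_le_div_iff_of_pos_right hε]
      rw [Real.log_div (by positivity) (by positivity), Real.log_mul (by norm_num) (by positivity)]
      have : Real.log 6 ≤ 2 := by
        rw [Real.log_le_iff_le_exp (by norm_num)]
        have := Real.exp_one_gt_d9
        rw [show (2:ℝ) = 1 + 1 by norm_num, Real.exp_add]
        nlinarith
      linarith
    have h1 : 1 ≤ (lT + d + l) / ε := by rw [le_div_iff₀ hε]; linarith
    calc E ≤ 3 * (240 * (d * l ^ 2) / ε) + (lT + d + l) / ε + 4 * (12 * (2 + lT + l) / ε) := by linarith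
      _ = (720 * (d * l^2) + (lT + d + l) + 48 * (2 + lT + l)) / ε := by ring
      _ ≤ _ := by
        gcongr
        linarith
  · have hj0 : j = 0 := by
      by_contra h
      have : (1:ℝ) ≤ j := by exact_mod_cast Nat.one_le_iff_ne_zero.2 h
      linarith
    refine (hE0 hj0).trans ?_
    rw [le_div_iff₀ hε]
    rcases hc.eq_or_lt with h0 | h0
    · rw [← h0, zero_mul]; nlinarith
    have hc1 : c ≤ 1 := by nlinarith
    have hcV : c / β ≤ V := by
      refine le_trans ?_ hVQ
      gcongr
      have : (1:ℝ) ≤ d * k := by nlinarith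
      nlinarith
    have hlnβ : - Real.log β ≤ l - Real.log c := by
      have := Real.log_le_log (by positivity) hcV
      rw [Real.log_div (by positivity) (by positivity)] at this
      linarith
    have hlnc : c * (-Real.log c) ≤ 1 := by
      have := Real.log_le_sub_one_of_pos (inv_pos.2 h0)
      rw [Real.log_inv] at this
      calc c * (-Real.log c) ≤ c * (c⁻¹ - 1) := by gcongr
        _ = 1 - c := by field_simp
        _ ≤ 1 := by linarith
    have : c * ε ≤ lT + d + l + 1 := by
      calc c * ε ≤ c * (lT + d + l - Real.log c) := by gcongr; linarith
        _ = c * (lT + d + l) + c * (-Real.log c) := by ring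
        _ ≤ 1 * (lT + d + l) + 1 := by gcongr
        _ = _ := by ring
    linarith

theorem histogram_queries_eps_dp :
    ∃ C : ℝ, 0 < C ∧
      ∀ (ε β : ℝ) (d k T : ℕ), 0 < ε → β ∈ Set.Ioo (0 : ℝ) 1 →
        1 ≤ d → 1 ≤ k → 1 ≤ T →
        ∀ q : Fin k → (Fin d → ℕ) → ℝ, (∀ i, MonotoneHistQuery (q i)) →
        ∃ M : (Fin T → Fin d → Bool) → Measure (Fin T → Fin k → ℝ),
          IsCOMech M ∧ IsEventDP ε M ∧
          ∀ x, ENNReal.ofReal (1 - β) ≤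
            M x {a | ∀ (t : Fin T) (i : Fin k),
              |a t i - q i (hist x t)| ≤
                C * ε⁻¹ * ((d : ℝ) * (log2c ((d : ℝ) * k * cmax q x / β)) ^ 2
                  + (k : ℝ) * log2c ((k : ℝ) * cmax q x / β) + log2c (T : ℝ))} := by
  refine ⟨1000, by norm_num, ?_⟩
  intro ε β d k T hε hβ hd hk hT q hq
  by_cases hreg : (T : ℝ) * (2 ^ d * Real.exp (-ε)) ≤ β
  · obtain ⟨M, h1, h2, h3⟩ := regimeA ε β d k T hε hreg q
    refine ⟨M, h1, h2, fun x => (h3 x).trans (measure_mono ?_)⟩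
    intro a ha t i
    rw [ha t i, sub_self, abs_zero]
    have e1 := log2c_ge_one ((k : ℝ) * cmax q x / β)
    have e2 := log2c_ge_one (T : ℝ)
    positivity
  · obtain ⟨M, h1, h2, h3⟩ := regimeB ε β d k T hε hβ hd hT q hq
    refine ⟨M, h1, h2, fun x => (h3 x).trans (measure_mono ?_)⟩
    intro a ha t i
    obtain ⟨j, j1, j2, j3⟩ := ha t i
    have hc : 0 ≤ cmax q x := ((hq i).1 _).trans (q_le_cmax q x i t)
    exact final_ineq ε β (cmax q x) _ d k T j hε hβ hd hk hT hc (not_le.1 hreg) j1 j2 j3
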